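/- Let (X,T) be a topological dynamical system for which there is a countable family of nonempty closed T-invariant sets M_1, M_2, … ⊆ X such that each subsystem (M_i, T|_{M_i}) is minimal and weakly mixing, each M_i contains at least two points, the union ⋃_i M_i is dense in X, and ⋃_i M_i equals the set of minimal points of (X,T). Then there exists a nonempty open set U ⊆ X such that for every z ∈ U the set N_T(z,U) is not a C*-set. -/

import Mathlib

open Set Function Filter Topology

structure TDS where
  carrier : Type
  [ms : MetricSpace carrier]
  [cs : CompactSpace carrier]
  map : carrier → carrier
  cont : Continuous map
  surj : Function.Surjective map

attribute [instance] TDS.ms TDS.cs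

def orbit {X : Type*} (T : X → X) (x : X) : Set X :=
  Set.range fun n : ℕ => T^[n] x

def IsMinimalSys {Y : Type*} [TopologicalSpace Y] (S : Y → Y) : Prop :=
  ∀ y : Y, Dense (orbit S y)

def IsTransitiveSys {X : Type*} [TopologicalSpace X] (T : X → X) : Prop :=
  ∀ U V : Set X, IsOpen U → IsOpen V → U.Nonempty → V.Nonempty →
    {n : ℕ | (U ∩ T^[n] ⁻¹' V).Nonempty}.Infinite

def IsWeaklyMixingSys {X : Type*} [TopologicalSpace X] (T : X → X) : Prop :=
  IsTransitiveSys fun p : X × X => (T p.1, T p.2)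

def IsJoining {X Y : Type*} [TopologicalSpace X] [TopologicalSpace Y]
    (T : X → X) (S : Y → Y) (J : Set (X × Y)) : Prop :=
  J.Nonempty ∧ IsClosed J ∧ (∀ p ∈ J, (T p.1, S p.2) ∈ J) ∧
    Prod.fst '' J = Set.univ ∧ Prod.snd '' J = Set.univ

def DisjointSys {X Y : Type*} [TopologicalSpace X] [TopologicalSpace Y]
    (T : X → X) (S : Y → Y) : Prop :=
  ∀ J : Set (X × Y), IsJoining T S J → J = Set.univ

def Syndetic (A : Set ℕ) : Prop :=
  ∃ N : ℕ, ∀ i : ℕ, ∃ j ≤ N, i + j ∈ A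

def Thick (A : Set ℕ) : Prop :=
  ∀ L : ℕ, ∃ n : ℕ, ∀ j ≤ L, n + j ∈ A

def IsMinimalPoint {X : Type*} [TopologicalSpace X] (T : X → X) (x : X) : Prop :=
  ∀ y ∈ closure (orbit T x), closure (orbit T x) ⊆ closure (orbit T y)

def Proximal {X : Type*} [MetricSpace X] (T : X → X) (x y : X) : Prop :=
  ∃ u : ℕ → ℕ, Filter.Tendsto (fun i => dist (T^[u i] x) (T^[u i] y)) Filter.atTop (nhds 0)

def IsDistalPoint {X : Type*} [MetricSpace X] (T : X → X) (x : X) : Prop :=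
  ∀ y ∈ closure (orbit T x), Proximal T x y → y = x

def DynSyndetic (B : Set ℕ) : Prop :=
  ∃ 𝒴 : TDS, IsMinimalSys 𝒴.map ∧
    ∃ (y : 𝒴.carrier) (V : Set 𝒴.carrier),
      IsOpen V ∧ y ∈ V ∧ {n : ℕ | 𝒴.map^[n] y ∈ V} ⊆ B

def CentralSet (S : Set ℕ) : Prop :=
  ∃ 𝒵 : TDS, ∃ (z w : 𝒵.carrier) (W : Set 𝒵.carrier),
    IsMinimalPoint 𝒵.map w ∧ Proximal 𝒵.map z w ∧ IsOpen W ∧ w ∈ W ∧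
    {n : ℕ | 𝒵.map^[n] z ∈ W} ⊆ S

def CStarSet (A : Set ℕ) : Prop :=
  ∀ S : Set ℕ, CentralSet S → (A ∩ S).Nonempty
theorem subset_closure_of_isMinimalSys_restrict {X : Type*} [TopologicalSpace X] {T : X → X}
    {M : Set X} (hinv : MapsTo T M M) (hmin : IsMinimalSys (hinv.restrict T M M))
    {x : X} (hx : x ∈ M) : M ⊆ closure (orbit T x) := by
  intro y hy
  have h : Subtype.val '' closure (orbit (hinv.restrict T M M) ⟨x, hx⟩) ⊆
      closure (Subtype.val '' orbit (hinv.restrict T M M) ⟨x, hx⟩) :=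
    image_closure_subset_closure_image continuous_subtype_val
  refine closure_mono ?_ (h ⟨⟨y, hy⟩, hmin _ _, rfl⟩)
  rintro _ ⟨_, ⟨n, rfl⟩, rfl⟩
  exact ⟨n, by simp [hinv.iterate_restrict n]⟩

theorem closure_orbit_subset {X : Type*} [TopologicalSpace X] {T : X → X} {K : Set X}
    (hK : IsClosed K) (hinv : MapsTo T K K) {x : X} (hx : x ∈ K) :
    closure (orbit T x) ⊆ K := by
  refine closure_minimal ?_ hK
  rintro _ ⟨n, rfl⟩
  exact hinv.iterate n hx

theorem mapsTo_closure_orbit {X : Type*} [TopologicalSpace X] {T : X → X} (hT : Continuous T)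
    (x : X) : MapsTo T (closure (orbit T x)) (closure (orbit T x)) := by
  refine MapsTo.closure ?_ hT
  rintro _ ⟨n, rfl⟩
  exact ⟨n + 1, iterate_succ_apply' T n x⟩

theorem exists_isMinimalPoint_mem_closure_orbit {X : Type*} [TopologicalSpace X] [CompactSpace X]
    {T : X → X} (hT : Continuous T) (z : X) :
    ∃ x ∈ closure (orbit T z), IsMinimalPoint T x := by
  let F : Set (Set X) := {K | IsClosed K ∧ K.Nonempty ∧ MapsTo T K K}
  have hz : closure (orbit T z) ∈ F :=
    ⟨isClosed_closure, ⟨z, subset_closure ⟨0, rfl⟩⟩, mapsTo_closure_orbit hT z⟩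
  obtain ⟨K, hKz, hK⟩ := zorn_superset_nonempty F (fun c hc hchain hne => by
    refine ⟨⋂₀ c, ⟨isClosed_sInter fun s hs => (hc hs).1, ?_, ?_⟩,
      fun s hs => sInter_subset_of_mem hs⟩
    · have := hne.to_subtype
      exact IsCompact.nonempty_sInter_of_directed_nonempty_isCompact_isClosed
        (fun a ha b hb => (hchain.total ha hb).elim
          (fun h => ⟨a, ha, Subset.rfl, h⟩) fun h => ⟨b, hb, h, Subset.rfl⟩)
        (fun s hs => (hc hs).2.1)
        (fun s hs => (hc hs).1.isCompact) (fun s hs => (hc hs).1)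
    · intro x hx s hs
      exact (hc hs).2.2 (hx s hs)) _ hz
  obtain ⟨hKc, ⟨x, hx⟩, hKi⟩ := hK.prop
  refine ⟨x, hKz hx, fun y hy => ?_⟩
  have hyK : y ∈ K := closure_orbit_subset hKc hKi hx hy
  have hyF : closure (orbit T y) ∈ F :=
    ⟨isClosed_closure, ⟨y, subset_closure ⟨0, rfl⟩⟩, mapsTo_closure_orbit hT y⟩
  exact (closure_orbit_subset hKc hKi hx).trans
    (hK.le_of_le hyF (closure_orbit_subset hKc hKi hyK))

/-- The set of transfer times from a nonempty open set to finitely many others contains the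
transfer times of a single pair of nonempty open sets. -/
theorem IsWeaklyMixingSys.exists_transfer_subset {Y : Type*} [TopologicalSpace Y] {S : Y → Y}
    (hS : Continuous S) (h : IsWeaklyMixingSys S) {ι : Type*} (s : Finset ι)
    {V : Set Y} (hV : IsOpen V) (hVne : V.Nonempty) (W : ι → Set Y)
    (hW : ∀ i, IsOpen (W i)) (hWne : ∀ i, (W i).Nonempty) :
    ∃ A B : Set Y, IsOpen A ∧ A.Nonempty ∧ IsOpen B ∧ B.Nonempty ∧
      ∀ n : ℕ, (A ∩ S^[n] ⁻¹' B).Nonempty → ∀ i ∈ s, (V ∩ S^[n] ⁻¹' W i).Nonempty := by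
  classical
  induction s using Finset.induction_on with
  | empty => exact ⟨V, V, hV, hVne, hV, hVne, by simp⟩
  | insert i s _ ih =>
    obtain ⟨A, B, hA, hAne, hB, hBne, hAB⟩ := ih
    obtain ⟨n, ⟨⟨a, b⟩, ⟨ha, hb⟩, hn⟩⟩ :=
      (h (A ×ˢ B) (V ×ˢ W i) (hA.prod hB) (hV.prod (hW i)) (hAne.prod hBne)
        (hVne.prod (hWne i))).nonempty
    have hn' : (S^[n] a, S^[n] b) ∈ V ×ˢ W i := by
      have := congrFun (Prod.map_iterate S S n) (a, b)
      change (Prod.map S S)^[n] (a, b) ∈ V ×ˢ W i at hn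
      rwa [this] at hn
    refine ⟨A ∩ S^[n] ⁻¹' V, B ∩ S^[n] ⁻¹' W i, hA.inter (hV.preimage (hS.iterate n)),
      ⟨a, ha, hn'.1⟩, hB.inter ((hW i).preimage (hS.iterate n)), ⟨b, hb, hn'.2⟩, ?_⟩
    rintro m ⟨x, ⟨hxA, hxV⟩, hxB, hxW⟩ k hk
    rcases Finset.mem_insert.1 hk with rfl | hk
    · refine ⟨S^[n] x, hxV, ?_⟩
      simp only [mem_preimage] at hxW ⊢
      rwa [← iterate_add_apply, Nat.add_comm, iterate_add_apply]
    · exact hAB m ⟨x, hxA, hxB⟩ k hk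

theorem IsMinimalSys.syndetic {Y : Type*} [TopologicalSpace Y] [CompactSpace Y] {S : Y → Y}
    (hS : Continuous S) (h : IsMinimalSys S) {B : Set Y} (hB : IsOpen B) (hBne : B.Nonempty)
    (y : Y) : Syndetic {n : ℕ | S^[n] y ∈ B} := by
  obtain ⟨t, ht⟩ := isCompact_univ.elim_finite_subcover (fun n : ℕ => S^[n] ⁻¹' B)
    (fun n => hB.preimage (hS.iterate n)) (fun x _ => by
      obtain ⟨_, hb, n, rfl⟩ := (h x).inter_open_nonempty B hB hBne
      exact mem_iUnion.2 ⟨n, hb⟩)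
  refine ⟨t.sup id, fun i => ?_⟩
  obtain ⟨j, hj, hjB⟩ := mem_iUnion₂.1 (ht (mem_univ (S^[i] y)))
  refine ⟨j, Finset.le_sup (f := id) hj, ?_⟩
  change S^[i + j] y ∈ B
  rwa [Nat.add_comm, iterate_add_apply]

/-- If a minimal weakly mixing subsystem lies in the orbit closure of `z`, the points of it that
come close to `z` under simultaneous iteration meet every nonempty relatively open set. -/
theorem exists_dist_iterate_lt {X : Type*} [MetricSpace X] [CompactSpace X] {T : X → X}
    (hT : Continuous T) {M : Set X} (hcl : IsClosed M) (hinv : MapsTo T M M)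
    (hmin : IsMinimalSys (hinv.restrict T M M)) (hwm : IsWeaklyMixingSys (hinv.restrict T M M))
    {z : X} (hz : M ⊆ closure (orbit T z)) {V : Set M} (hV : IsOpen V) (hVne : V.Nonempty)
    {ε : ℝ} (hε : 0 < ε) : ∃ y ∈ V, ∃ n : ℕ, dist (T^[n] z) (T^[n] y) < ε := by
  have : CompactSpace M := isCompact_iff_compactSpace.1 hcl.isCompact
  have hS : Continuous (hinv.restrict T M M) := hT.restrict hinv
  have hcoe (n : ℕ) (y : M) : ((hinv.restrict T M M)^[n] y : X) = T^[n] y := by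
    simp [hinv.iterate_restrict n]
  obtain ⟨t, ht⟩ := isCompact_univ.elim_finite_subcover (fun c : M => Metric.ball c (ε / 4))
    (fun _ => Metric.isOpen_ball)
    (fun x _ => mem_iUnion.2 ⟨x, Metric.mem_ball_self (by positivity)⟩)
  obtain ⟨A, B, hA, ⟨a, ha⟩, hB, hBne, hAB⟩ := hwm.exists_transfer_subset hS t hV hVne
    (fun c => Metric.ball c (ε / 4)) (fun _ => Metric.isOpen_ball)
    (fun c => ⟨c, Metric.mem_ball_self (by positivity)⟩)
  obtain ⟨L, hL⟩ := hmin.syndetic hS hB hBne a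
  obtain ⟨x, -⟩ := hVne
  have hnear : ∀ᶠ u in 𝓝 (x : X), ∀ j ∈ Finset.range (L + 1),
      dist (T^[j] u) (T^[j] x) < ε / 2 := by
    rw [Filter.eventually_all_finset]
    intro j _
    exact (hT.iterate j).continuousAt.eventually (Metric.ball_mem_nhds _ (by positivity))
  obtain ⟨_, hu, m, rfl⟩ := mem_closure_iff_nhds.1 (hz x.2) _ hnear
  obtain ⟨j, hj, hjB⟩ := hL m
  obtain ⟨c, hc, hxc⟩ := mem_iUnion₂.1 (ht (mem_univ ((hinv.restrict T M M)^[j] x)))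
  obtain ⟨y, hyV, hyc⟩ := hAB (m + j) ⟨a, ha, hjB⟩ c hc
  refine ⟨y, hyV, m + j, ?_⟩
  have h₁ : dist (T^[m + j] z) (T^[j] x) < ε / 2 := by
    rw [Nat.add_comm, iterate_add_apply]
    exact hu j (Finset.mem_range.2 (Nat.lt_succ_of_le hj))
  have h₂ : dist (T^[j] (x : X)) c < ε / 4 := by
    rw [← hcoe]; exact hxc
  have h₃ : dist (T^[m + j] (y : X)) c < ε / 4 := by
    rw [← hcoe]; exact hyc
  linarith [dist_triangle (T^[m + j] z) (T^[j] x) (T^[m + j] y),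
    dist_triangle_right (T^[j] (x : X)) (T^[m + j] y) c]

/-- In a minimal weakly mixing subsystem contained in the orbit closure of `z`, the points proximal
to `z` are dense. -/
theorem exists_proximal_mem {X : Type*} [MetricSpace X] [CompactSpace X] {T : X → X}
    (hT : Continuous T) {M : Set X} (hcl : IsClosed M) (hinv : MapsTo T M M)
    (hmin : IsMinimalSys (hinv.restrict T M M)) (hwm : IsWeaklyMixingSys (hinv.restrict T M M))
    {z : X} (hz : M ⊆ closure (orbit T z)) {W : Set X} (hW : IsOpen W) (hne : (M ∩ W).Nonempty) :
    ∃ w ∈ M ∩ W, Proximal T z w := by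
  have : CompactSpace M := isCompact_iff_compactSpace.1 hcl.isCompact
  let G (k : ℕ) : Set M := {y | ∃ n : ℕ, dist (T^[n] z) (T^[n] y) < 1 / ((k : ℝ) + 1)}
  have hGopen (k : ℕ) : IsOpen (G k) := by
    simp only [G, ofPred_exists]
    refine isOpen_iUnion fun n => isOpen_lt ?_ continuous_const
    exact continuous_const.dist ((hT.iterate n).comp continuous_subtype_val)
  have hGdense (k : ℕ) : Dense (G k) := dense_iff_inter_open.2 fun V hV hVne => by
    obtain ⟨y, hy, hn⟩ := exists_dist_iterate_lt hT hcl hinv hmin hwm hz hV hVne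
      (ε := 1 / ((k : ℝ) + 1)) Nat.one_div_pos_of_nat
    exact ⟨y, hy, hn⟩
  obtain ⟨x, hxM, hxW⟩ := hne
  obtain ⟨y, hyW, hy⟩ := (dense_iInter_of_isOpen hGopen hGdense).inter_open_nonempty
    (Subtype.val ⁻¹' W) (hW.preimage continuous_subtype_val) ⟨⟨x, hxM⟩, hxW⟩
  choose u hu using fun k => mem_iInter.1 hy k
  exact ⟨y, ⟨y.2, hyW⟩, u, squeeze_zero (fun _ => dist_nonneg) (fun k => (hu k).le)
    tendsto_one_div_add_atTop_nhds_zero_nat⟩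

theorem isMinimalPoint_of_isFixedPt {X : Type*} [TopologicalSpace X] [T1Space X] {T : X → X}
    {x : X} (hx : IsFixedPt T x) : IsMinimalPoint T x := by
  have h : orbit T x = {x} := by
    ext y
    simp [orbit, (hx.iterate _).eq, eq_comm]
  intro y hy
  rw [h, closure_singleton, mem_singleton_iff] at hy
  rw [hy]

theorem stmt_14 {X : Type} [MetricSpace X] [CompactSpace X] (T : X → X)
    (hTc : Continuous T) (hTs : Function.Surjective T)
    (M : ℕ → Set X) (hne : ∀ i, (M i).Nonempty) (hcl : ∀ i, IsClosed (M i))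
    (hinv : ∀ i, Set.MapsTo T (M i) (M i))
    (hmin : ∀ i, IsMinimalSys (Set.MapsTo.restrict T (M i) (M i) (hinv i)))
    (hwm : ∀ i, IsWeaklyMixingSys (Set.MapsTo.restrict T (M i) (M i) (hinv i)))
    (hnontriv : ∀ i, ∃ a ∈ M i, ∃ b ∈ M i, a ≠ b)
    (hdense : Dense (⋃ i, M i))
    (heq : (⋃ i, M i) = {x : X | IsMinimalPoint T x}) :
    ∃ U : Set X, IsOpen U ∧ U.Nonempty ∧
      ∀ z ∈ U, ¬ CStarSet {n : ℕ | T^[n] z ∈ U} := by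
  have hfix (x : X) : T x ≠ x := fun hx => by
    have hxM : x ∈ ⋃ i, M i := heq.superset (isMinimalPoint_of_isFixedPt hx)
    obtain ⟨i, hi⟩ := mem_iUnion.1 hxM
    obtain ⟨a, ha, b, hb, hab⟩ := hnontriv i
    have hsub : M i ⊆ {x} :=
      (subset_closure_of_isMinimalSys_restrict (hinv i) (hmin i) hi).trans
        (closure_orbit_subset isClosed_singleton (by simpa [MapsTo] using hx) rfl)
    exact hab ((hsub ha).trans (hsub hb).symm)
  obtain ⟨x₀, -⟩ := hne 0
  obtain ⟨p, -, hp⟩ := isCompact_univ.exists_isMinOn ⟨x₀, mem_univ _⟩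
    (hTc.dist continuous_id).continuousOn
  set δ := dist (T p) p
  have hδ : 0 < δ := dist_pos.2 (hfix p)
  have hle (x : X) : δ ≤ dist (T x) x := hp (mem_univ x)
  refine ⟨Metric.ball x₀ (δ / 3), Metric.isOpen_ball, ⟨x₀, Metric.mem_ball_self (by positivity)⟩,
    fun z _ hC => ?_⟩
  obtain ⟨x, hxz, hx⟩ := exists_isMinimalPoint_mem_closure_orbit hTc z
  have hxM : x ∈ ⋃ i, M i := heq.superset hx
  obtain ⟨i, hi⟩ := mem_iUnion.1 hxM
  have hMz : M i ⊆ closure (orbit T z) :=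
    (subset_closure_of_isMinimalSys_restrict (hinv i) (hmin i) hi).trans
      (closure_orbit_subset isClosed_closure (mapsTo_closure_orbit hTc z) hxz)
  have hout : (M i ∩ (Metric.closedBall x₀ (δ / 3))ᶜ).Nonempty := by
    by_contra hempty
    have hsub : M i ⊆ Metric.closedBall x₀ (δ / 3) := fun y hy => by
      by_contra hyB
      exact hempty ⟨y, hy, hyB⟩
    have h₁ := Metric.mem_closedBall.1 (hsub hi)
    have h₂ := Metric.mem_closedBall.1 (hsub (hinv i hi))
    linarith [hle x, dist_triangle_right (T x) x x₀]
  obtain ⟨w, ⟨hwM, hwB⟩, hzw⟩ := exists_proximal_mem hTc (hcl i) (hinv i) (hmin i) (hwm i) hMz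
    Metric.isClosed_closedBall.isOpen_compl hout
  have hw : IsMinimalPoint T w := heq.subset (mem_iUnion.2 ⟨i, hwM⟩)
  obtain ⟨n, hn, hn'⟩ := hC {n : ℕ | T^[n] z ∈ (Metric.closedBall x₀ (δ / 3))ᶜ}
    ⟨⟨X, T, hTc, hTs⟩, z, w, _, hw, hzw, Metric.isClosed_closedBall.isOpen_compl, hwB,
      Subset.rfl⟩
  exact hn' (Metric.ball_subset_closedBall hn)
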